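/- Suppose 2k < n. Let u, v be positive C² functions on a bounded domain Ω ⊆ ℝⁿ with closure, with eigenvalues of A(u) and A(v) in Γ_k pointwise, satisfying v⁻ⁿ·S_k(v) ≤ u⁻ⁿ·S_k(u) in Ω and v ≥ u on ∂Ω. Assume furthermore (as established in the paper's comparison argument) that on any open set where u > v the function w_t = (1−t)u + tv satisfies S_k(w_t) = 0 for all t implies u ≡ v there. Then u ≤ v throughout Ω. -/

import Mathlib

open scoped BigOperators Classical
open MeasureTheory

noncomputable section

abbrev E (n : ℕ) := EuclideanSpace ℝ (Fin n)

/-- k-th elementary symmetric polynomial of a vector in ℝⁿ. -/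
def esymm (n k : ℕ) (lam : Fin n → ℝ) : ℝ :=
  ∑ s ∈ Finset.univ.powersetCard k, ∏ i ∈ s, lam i

/-- Eigenvalue vector of a real symmetric matrix (junk value 0 otherwise). -/
def eigs {n : ℕ} (M : Matrix (Fin n) (Fin n) ℝ) : Fin n → ℝ :=
  if h : M.IsHermitian then h.eigenvalues else 0

/-- σ_k of the eigenvalues of a symmetric matrix. -/
def Sk (n k : ℕ) (M : Matrix (Fin n) (Fin n) ℝ) : ℝ := esymm n k (eigs M)

/-- The (closed) Gårding cone Γ_k. -/
def GammaK (n k : ℕ) : Set (Fin n → ℝ) :=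
  {lam | ∀ i, 1 ≤ i → i ≤ k → 0 ≤ esymm n i lam}

/-- i-th partial derivative. -/
def pd {n : ℕ} (u : E n → ℝ) (i : Fin n) (x : E n) : ℝ :=
  fderiv ℝ u x (EuclideanSpace.single i 1)

/-- Hessian matrix. -/
def hess {n : ℕ} (u : E n → ℝ) (x : E n) : Matrix (Fin n) (Fin n) ℝ :=
  Matrix.of fun i j => pd (fun y => pd u j y) i x

/-- |∇u|². -/
def gradsq {n : ℕ} (u : E n → ℝ) (x : E n) : ℝ := ∑ i, (pd u i x) ^ 2

/-- The conformal Schouten-type matrix A_{ij}(u) = u u_{ij} - (1/2)|∇u|² δ_{ij}. -/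
def Amat {n : ℕ} (u : E n → ℝ) (x : E n) : Matrix (Fin n) (Fin n) ℝ :=
  Matrix.of fun i j => u x * hess u x i j - (1 / 2) * gradsq u x * (if i = j then 1 else 0)

open Polynomial in
theorem aux_laguerre (s : Multiset ℝ) (x : ℝ) :
    (s.map (fun a => X + C a)).prod.eval x *
      (derivative (derivative (s.map (fun a => X + C a)).prod)).eval x
      ≤ ((derivative (s.map (fun a => X + C a)).prod).eval x) ^ 2 := by
  induction s using Multiset.induction with
  | empty => simp
  | cons a s ih =>
    simp only [Multiset.map_cons, Multiset.prod_cons, derivative_mul, derivative_add, derivative_X,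
      derivative_C, eval_add, eval_mul, eval_X, eval_C,
      add_zero, one_mul]
    generalize eval x (s.map (fun a => X + C a)).prod = p at *
    generalize eval x (derivative (s.map (fun a => X + C a)).prod) = q at *
    generalize eval x (derivative (derivative (s.map (fun a => X + C a)).prod)) = r at *
    nlinarith [mul_nonneg (sq_nonneg (x + a)) (sub_nonneg.2 ih), sq_nonneg p]

open Polynomial in
theorem aux_laguerre' (p : ℝ[X]) (hp : p.Splits) (x : ℝ) :
    p.eval x * (derivative (derivative p)).eval x ≤ ((derivative p).eval x) ^ 2 := by
  obtain ⟨m, hm⟩ := splits_iff_exists_multiset'.1 hp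
  rw [hm]
  have := aux_laguerre m x
  simp only [derivative_C_mul, eval_mul, eval_C]
  nlinarith [mul_nonneg (sq_nonneg p.leadingCoeff) (sub_nonneg.2 this)]

open Polynomial in
theorem aux_splits_deriv (p : ℝ[X]) (hp : p.Splits) : (derivative p).Splits := by
  rw [splits_iff_card_roots] at *
  have h1 := card_roots_le_derivative p
  have h2 := card_roots' (derivative p)
  have h3 := natDegree_derivative_le p
  by_cases h0 : p.natDegree = 0
  · omega
  · omega

open Polynomial in
theorem aux_newton (p : ℝ[X]) (hp : p.Splits) (j : ℕ) :
    p.coeff j * p.coeff (j+2) ≤ p.coeff (j+1) ^ 2 := by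
  have hs : ∀ j, (derivative^[j] p).Splits := by
    intro j
    induction j with
    | zero => simpa
    | succ j ih => rw [Function.iterate_succ_apply']; exact aux_splits_deriv _ ih
  have h := aux_laguerre' _ (hs j) 0
  rw [← Function.iterate_succ_apply' derivative, ← Function.iterate_succ_apply' derivative,
    ← coeff_zero_eq_eval_zero, ← coeff_zero_eq_eval_zero, ← coeff_zero_eq_eval_zero,
    coeff_iterate_derivative, coeff_iterate_derivative, coeff_iterate_derivative] at h
  simp only [zero_add, Nat.descFactorial_self, nsmul_eq_mul, Nat.succ_eq_add_one,
    Nat.factorial_succ] at h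
  have hf : (0:ℝ) < (j.factorial : ℝ) := by positivity
  push_cast at h
  by_cases hc : p.coeff j * p.coeff (j+2) ≤ 0
  · exact hc.trans (sq_nonneg _)
  · push Not at hc
    have h' : (j.factorial:ℝ)^2 * (j+1) * ((j+2) * (p.coeff j * p.coeff (j+2)))
      ≤ (j.factorial:ℝ)^2 * (j+1) * ((j+1) * p.coeff (j+1)^2) := by
      ring_nf at h ⊢; linarith
    have h2 := le_of_mul_le_mul_left h' (by positivity)
    have hj : (0:ℝ) < j + 1 := by positivity
    nlinarith

/-- elementary symmetric function over a finset. -/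
def es {n : ℕ} (s : Finset (Fin n)) (j : ℕ) (l : Fin n → ℝ) : ℝ :=
  ∑ t ∈ s.powersetCard j, ∏ i ∈ t, l i

open Polynomial in
theorem es_coeff {n : ℕ} (s : Finset (Fin n)) (j m : ℕ) (h : j + m = s.card) (l : Fin n → ℝ) :
    es s j l = (∏ i ∈ s, (X + C (l i))).coeff m := by
  rw [Finset.prod_X_add_C_coeff _ _ (by omega)]
  rw [es]; congr 2; omega

theorem es_zero {n : ℕ} (s : Finset (Fin n)) (l : Fin n → ℝ) : es s 0 l = 1 := by simp [es]

theorem es_gt {n : ℕ} (s : Finset (Fin n)) (j : ℕ) (h : s.card < j) (l : Fin n → ℝ) :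
    es s j l = 0 := by
  rw [es, Finset.powersetCard_eq_empty.2 h]; simp

theorem es_newton {n : ℕ} (s : Finset (Fin n)) (j : ℕ) (l : Fin n → ℝ) :
    es s j l * es s (j+2) l ≤ es s (j+1) l ^ 2 := by
  by_cases h : s.card < j + 2
  · rw [es_gt s (j+2) h, mul_zero]; positivity
  · obtain ⟨m, hm⟩ := Nat.exists_eq_add_of_le (not_lt.1 h)
    rw [es_coeff s (j+2) m hm.symm, es_coeff s (j+1) (m+1) (by omega),
      es_coeff s j (m+2) (by omega), mul_comm]
    exact aux_newton _ (Polynomial.Splits.prod fun i _ => Polynomial.Splits.X_add_C _) m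

theorem es_rec {n : ℕ} (s : Finset (Fin n)) (i : Fin n) (hi : i ∈ s) (j : ℕ) (l : Fin n → ℝ) :
    es s (j+1) l = es (s.erase i) (j+1) l + l i * es (s.erase i) j l := by
  have hn : i ∉ s.erase i := Finset.notMem_erase _ _
  conv_lhs => rw [← Finset.insert_erase hi]
  rw [es, Finset.powersetCard_succ_insert hn, Finset.sum_union, Finset.sum_image, es, es,
    Finset.mul_sum]
  · congr 1
    apply Finset.sum_congr rfl
    intro t ht
    rw [Finset.prod_insert]
    intro h
    exact hn ((Finset.mem_powersetCard.1 ht).1 h)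
  · intro a ha b hb hab
    have h1 : i ∉ a := fun h => hn ((Finset.mem_powersetCard.1 ha).1 h)
    have h2 : i ∉ b := fun h => hn ((Finset.mem_powersetCard.1 hb).1 h)
    have := congrArg (fun z => Finset.erase z i) hab
    simpa [Finset.erase_insert h1, Finset.erase_insert h2] using this
  · rw [Finset.disjoint_left]
    intro a ha hb
    obtain ⟨b, _, rfl⟩ := Finset.mem_image.1 hb
    exact hn ((Finset.mem_powersetCard.1 ha).1 (Finset.mem_insert_self _ _))

theorem es_cone_pos {n : ℕ} (s : Finset (Fin n)) (i : Fin n) (hi : i ∈ s) (l : Fin n → ℝ) (k : ℕ)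
    (h : ∀ j ≤ k, 0 < es s j l) : ∀ j < k, 0 < es (s.erase i) j l := by
  intro j
  induction j with
  | zero => intro _; rw [es_zero]; norm_num
  | succ j ih =>
    intro hj
    by_contra hc
    push Not at hc
    have h0 := ih (by omega)
    have h1 := h (j+1) (by omega)
    have h2 := h (j+2) (by omega)
    rw [es_rec s i hi] at h1 h2
    have hN := es_newton (s.erase i) j l
    generalize es (s.erase i) j l = a at *
    generalize es (s.erase i) (j+1) l = b at *
    generalize es (s.erase i) (j+1+1) l = c at *
    nlinarith [mul_pos h0 h2]

open Polynomial in
theorem es_shift {n : ℕ} (l : Fin n → ℝ) (k : ℕ) (hk : k ≤ n)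
    (h : ∀ i, 1 ≤ i → i ≤ k → 0 ≤ es Finset.univ i l) (d : ℝ) (hd : 0 < d) (i : ℕ) (hi : 1 ≤ i)
    (hik : i ≤ k) : es Finset.univ i l < es Finset.univ i (fun a => l a + d) := by
  have hcard : (Finset.univ : Finset (Fin n)).card = n := by simp
  rw [es_coeff _ i (n - i) (by omega), es_coeff _ i (n - i) (by omega)]
  have h1 : (∏ a, (X + C (l a + d))) = taylor d (∏ a, (X + C (l a))) := by
    rw [taylor_apply, prod_comp]
    apply Finset.prod_congr rfl
    intro a _
    simp; ring
  set P := ∏ a, (X + C (l a)) with hP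
  rw [h1, taylor_coeff]
  have hdeg : P.natDegree = n := by
    rw [hP, natDegree_prod_of_monic _ _ (fun a _ => monic_X_add_C _)]; simp
  have hlt : (hasseDeriv (n - i) P).natDegree < i + 1 := by
    have := natDegree_hasseDeriv_le P (n - i)
    omega
  rw [eval_eq_sum_range' hlt, Finset.sum_range_succ, Finset.sum_range_eq_add_Ico _ (by omega)]
  have e0 : (hasseDeriv (n - i) P).coeff 0 = P.coeff (n - i) := by
    simp [hasseDeriv_coeff]
  have ei : 0 < (hasseDeriv (n - i) P).coeff i := by
    rw [hasseDeriv_coeff]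
    have : P.coeff (i + (n - i)) = 1 := by
      rw [← es_coeff _ 0 _ (by omega), es_zero]
    rw [this]
    have := Nat.choose_pos (show n - i ≤ i + (n - i) by omega)
    simpa using this
  have em : 0 ≤ ∑ x ∈ Finset.Ico 1 i, (hasseDeriv (n - i) P).coeff x * d ^ x := by
    apply Finset.sum_nonneg
    intro x hx
    rw [Finset.mem_Ico] at hx
    rw [hasseDeriv_coeff, ← es_coeff _ (i - x) (x + (n - i)) (by omega)]
    have := h (i - x) (by omega) (by omega)
    positivity
  rw [e0]
  have : 0 < (hasseDeriv (n - i) P).coeff i * d ^ i := by positivity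
  simp only [pow_zero, mul_one]
  linarith

theorem es_cone {n : ℕ} (l : Fin n → ℝ) (k : ℕ) (hk : k ≤ n)
    (h : ∀ i, 1 ≤ i → i ≤ k → 0 ≤ es Finset.univ i l) (i : Fin n) (j : ℕ) (hj : j < k) :
    0 ≤ es (Finset.univ.erase i) j l := by
  have hc : Continuous (fun d : ℝ => es (Finset.univ.erase i) j (fun a => l a + d)) := by
    unfold es
    fun_prop
  have hpos : ∀ d : ℝ, 0 < d → 0 < es (Finset.univ.erase i) j (fun a => l a + d) := by
    intro d hd
    apply es_cone_pos Finset.univ i (Finset.mem_univ _) _ k _ j hj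
    intro m hm
    rcases Nat.eq_zero_or_pos m with rfl | h0
    · rw [es_zero]; norm_num
    · exact (h m h0 hm).trans_lt (es_shift l k hk h d hd m h0 hm)
  have ht : Filter.Tendsto (fun d : ℝ => es (Finset.univ.erase i) j (fun a => l a + d))
      (nhdsWithin 0 (Set.Ioi 0)) (nhds (es (Finset.univ.erase i) j l)) := by
    have := (hc.tendsto 0).mono_left (nhdsWithin_le_nhds (s := Set.Ioi 0))
    simpa using this
  apply ge_of_tendsto ht
  filter_upwards [self_mem_nhdsWithin] with d hd
  exact (hpos d hd).le

theorem esymm_eq_es (n k : ℕ) (l : Fin n → ℝ) : esymm n k l = es Finset.univ k l := by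
  rw [esymm, es]

theorem eigs_eq {n : ℕ} {M : Matrix (Fin n) (Fin n) ℝ} (hM : M.IsHermitian) :
    eigs M = hM.eigenvalues := by rw [eigs, dif_pos hM]

theorem prod_eigs {n : ℕ} {M : Matrix (Fin n) (Fin n) ℝ} (hM : M.IsHermitian) (t : ℝ) :
    ∏ a, (t + eigs M a) = (Matrix.scalar (Fin n) t + M).det := by
  have h := congrArg (Polynomial.eval (-t)) hM.charpoly_eq
  rw [Matrix.eval_charpoly, Polynomial.eval_prod] at h
  have e1 : Matrix.scalar (Fin n) (-t) - M = -(Matrix.scalar (Fin n) t + M) := by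
    rw [map_neg]; abel
  rw [e1, Matrix.det_neg] at h
  have e2 : ∀ a, Polynomial.eval (-t) (Polynomial.X - Polynomial.C (hM.eigenvalues a)) =
      (-1) * (t + eigs M a) := by
    intro a; rw [eigs_eq hM]; simp; ring
  simp only [RCLike.ofReal_real_eq_id, id_eq] at h
  rw [Finset.prod_congr rfl (fun a _ => e2 a), Finset.prod_mul_distrib] at h
  simp only [Finset.prod_const, Finset.card_univ] at h
  have := mul_left_cancel₀ (by positivity) h
  exact this.symm

theorem es_congr {n : ℕ} (l l' : Fin n → ℝ) (h : ∀ t, ∏ a, (t + l a) = ∏ a, (t + l' a)) (i : ℕ) :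
    es Finset.univ i l = es Finset.univ i l' := by
  have hcard : (Finset.univ : Finset (Fin n)).card = n := by simp
  by_cases hi : n < i
  · rw [es_gt _ _ (by omega), es_gt _ _ (by omega)]
  · rw [es_coeff _ i (n - i) (by omega), es_coeff _ i (n - i) (by omega)]
    congr 1
    apply Polynomial.funext
    intro t
    simpa [Polynomial.eval_prod] using h t

theorem sk_shift {n : ℕ} {M : Matrix (Fin n) (Fin n) ℝ} (hM : M.IsHermitian) (d : ℝ) (i : ℕ) :
    Sk n i (M + Matrix.scalar (Fin n) d) = es Finset.univ i (fun a => eigs M a + d) := by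
  have hd : (M + Matrix.scalar (Fin n) d).IsHermitian := by
    apply hM.add
    simp [Matrix.IsHermitian]
  rw [Sk, esymm_eq_es]
  apply es_congr
  intro t
  rw [prod_eigs hd]
  have := prod_eigs hM (t + d)
  rw [map_add] at this
  rw [show Matrix.scalar (Fin n) t + (M + Matrix.scalar (Fin n) d) =
    Matrix.scalar (Fin n) t + Matrix.scalar (Fin n) d + M by abel, ← this]
  apply Finset.prod_congr rfl; intros; ring

theorem sk_smul {n : ℕ} {M : Matrix (Fin n) (Fin n) ℝ} (hM : M.IsHermitian) (c : ℝ) (hc : c ≠ 0)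
    (i : ℕ) : Sk n i (c • M) = c ^ i * Sk n i M := by
  have hd : (c • M).IsHermitian := by
    rw [Matrix.IsHermitian, Matrix.conjTranspose_smul, hM]; simp
  rw [Sk, esymm_eq_es, Sk, esymm_eq_es, es_congr _ (fun a => c * eigs M a)]
  · rw [es, es, Finset.mul_sum]
    apply Finset.sum_congr rfl
    intro t ht
    rw [Finset.prod_mul_distrib, Finset.prod_const, (Finset.mem_powersetCard.1 ht).2]
  · intro t
    rw [prod_eigs hd]
    have e : Matrix.scalar (Fin n) t + c • M = c • (Matrix.scalar (Fin n) (t/c) + M) := by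
      ext a b
      by_cases hab : a = b
      · subst hab; simp; field_simp
      · simp [hab]
    rw [e, Matrix.det_smul, ← prod_eigs hM, ← Finset.card_univ, ← Finset.prod_const,
      ← Finset.prod_mul_distrib]
    apply Finset.prod_congr rfl; intros; field_simp

theorem det_diag_rank_one {n : ℕ} (d q : Fin n → ℝ) (hd : ∀ a, d a ≠ 0) :
    (Matrix.diagonal d + Matrix.vecMulVec q q).det =
      ∏ a, d a + ∑ a, q a ^ 2 * ∏ b ∈ Finset.univ.erase a, d b := by
  have hu : IsUnit (Matrix.diagonal d).det := by
    rw [Matrix.det_diagonal]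
    exact (Finset.prod_ne_zero_iff.2 fun a _ => hd a).isUnit
  have hinv : (Matrix.diagonal d)⁻¹ = Matrix.diagonal (fun a => (d a)⁻¹) := by
    apply Matrix.inv_eq_right_inv
    rw [Matrix.diagonal_mul_diagonal]
    ext a b
    by_cases hab : a = b
    · subst hab; simp [hd]
    · simp [hab]
  rw [Matrix.vecMulVec_eq Unit, Matrix.det_add_replicateCol_mul_replicateRow hu, hinv,
    Matrix.det_diagonal, Matrix.det_unique]
  have : (1 + (Matrix.replicateRow Unit q * Matrix.diagonal (fun a => (d a)⁻¹) *
      Matrix.replicateCol Unit q : Matrix Unit Unit ℝ)) default default = 1 + ∑ a, q a * (d a)⁻¹ * q a := by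
    simp [Matrix.mul_apply, Matrix.diagonal_apply]
  rw [this, mul_add, mul_one, Finset.mul_sum]
  congr 1
  apply Finset.sum_congr rfl
  intro a _
  rw [← Finset.mul_prod_erase _ _ (Finset.mem_univ a)]
  have := hd a
  field_simp

open Matrix in
theorem sk_rank_one {n : ℕ} {M : Matrix (Fin n) (Fin n) ℝ} (hM : M.IsHermitian) (p : Fin n → ℝ) :
    ∃ q : Fin n → ℝ, ∀ i, i + 1 ≤ n → Sk n (i+1) (M + Matrix.vecMulVec p p) =
      Sk n (i+1) M + ∑ a, q a ^ 2 * es (Finset.univ.erase a) i (eigs M) := by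
  have hcard : (Finset.univ : Finset (Fin n)).card = n := by simp
  have hM' : (M + Matrix.vecMulVec p p).IsHermitian := by
    apply hM.add
    ext a b; simp [Matrix.vecMulVec_apply, mul_comm]
  let U : Matrix (Fin n) (Fin n) ℝ := hM.eigenvectorUnitary
  have hU : U * star U = 1 := Unitary.coe_mul_star_self _
  have hU' : star U * U = 1 := Unitary.coe_star_mul_self _
  have hsp : M = U * Matrix.diagonal (eigs M) * star U := by
    have := hM.spectral_theorem
    rw [Unitary.conjStarAlgAut_apply] at this
    rw [eigs_eq hM]; exact this
  refine ⟨star U *ᵥ p, ?_⟩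
  set q := star U *ᵥ p with hq
  have hp : U *ᵥ q = p := by rw [hq, Matrix.mulVec_mulVec, hU, Matrix.one_mulVec]
  have hdet : ∀ t, (Matrix.scalar (Fin n) t + (M + Matrix.vecMulVec p p)).det =
      (Matrix.diagonal (fun a => t + eigs M a) + Matrix.vecMulVec q q).det := by
    intro t
    have h1 : Matrix.vecMulVec p p = U * Matrix.vecMulVec q q * star U := by
      rw [Matrix.mul_vecMulVec, Matrix.vecMulVec_mul, hp]
      congr 1
      rw [← hp, Matrix.star_eq_conjTranspose, Matrix.conjTranspose_eq_transpose_of_trivial, Matrix.vecMul_transpose]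
    have h2 : Matrix.scalar (Fin n) t = U * Matrix.scalar (Fin n) t * star U := by
      rw [← Matrix.scalar_comm t (fun _ => mul_comm _ _), Matrix.mul_assoc, hU, Matrix.mul_one]
    have h3 : Matrix.diagonal (fun a => t + eigs M a) =
        Matrix.scalar (Fin n) t + Matrix.diagonal (eigs M) := by
      simp
    have h4 : Matrix.scalar (Fin n) t + (M + Matrix.vecMulVec p p) =
      U * (Matrix.diagonal (fun a => t + eigs M a) + Matrix.vecMulVec q q) * star U := by
      rw [h3, Matrix.mul_add, Matrix.mul_add, Matrix.add_mul, Matrix.add_mul, ← h1, ← h2, ← hsp,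
        add_assoc]
    rw [h4, Matrix.det_mul, Matrix.det_mul, mul_right_comm, ← Matrix.det_mul, hU]
    simp
  have hpoly : ∏ a, (Polynomial.X + Polynomial.C (eigs (M + Matrix.vecMulVec p p) a)) =
      ∏ a, (Polynomial.X + Polynomial.C (eigs M a)) +
      ∑ a, Polynomial.C (q a ^ 2) *
        ∏ b ∈ Finset.univ.erase a, (Polynomial.X + Polynomial.C (eigs M b)) := by
    apply Polynomial.eq_of_infinite_eval_eq
    apply (Set.Ioi_infinite (∑ a, |eigs M a|)).mono
    intro t ht
    simp only [Set.mem_ofPred_eq, Polynomial.eval_prod, Polynomial.eval_add, Polynomial.eval_X,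
      Polynomial.eval_C, Polynomial.eval_finsetSum, Polynomial.eval_mul]
    rw [prod_eigs hM', hdet, det_diag_rank_one]
    intro a
    have h1 : |eigs M a| ≤ ∑ a, |eigs M a| :=
      Finset.single_le_sum (f := fun a => |eigs M a|) (fun _ _ => abs_nonneg _) (Finset.mem_univ a)
    have h2 := neg_abs_le (eigs M a)
    have : t > ∑ a, |eigs M a| := ht
    apply ne_of_gt; linarith
  intro i hi
  rw [Sk, Sk, esymm_eq_es, esymm_eq_es, es_coeff _ (i+1) (n - (i+1)) (by omega), hpoly,
    es_coeff _ (i+1) (n - (i+1)) (by omega), Polynomial.coeff_add, Polynomial.finsetSum_coeff]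
  congr 1
  apply Finset.sum_congr rfl
  intro a _
  rw [Polynomial.coeff_C_mul, es_coeff _ i (n - (i+1))]
  rw [Finset.card_erase_of_mem (Finset.mem_univ _)]; omega

theorem sk_mono_rank_one {n k : ℕ} (hk : k ≤ n) {M : Matrix (Fin n) (Fin n) ℝ}
    (hM : M.IsHermitian) (hG : eigs M ∈ GammaK n k) (p : Fin n → ℝ) (i : ℕ) (hi : 1 ≤ i)
    (hik : i ≤ k) : Sk n i M ≤ Sk n i (M + Matrix.vecMulVec p p) := by
  obtain ⟨q, hq⟩ := sk_rank_one hM p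
  obtain ⟨i, rfl⟩ : ∃ j, i = j + 1 := ⟨i - 1, by omega⟩
  rw [hq i (by omega)]
  have : 0 ≤ ∑ a, q a ^ 2 * es (Finset.univ.erase a) i (eigs M) := by
    apply Finset.sum_nonneg
    intro a _
    apply mul_nonneg (sq_nonneg _)
    apply es_cone _ k hk _ _ _ (by omega)
    intro j hj hjk
    rw [← esymm_eq_es]; exact hG j hj hjk
  linarith

theorem sk_mono_sum {n k : ℕ} (hk : k ≤ n) {ι : Type} (s : Finset ι) (B : ι → Fin n → ℝ)
    {M : Matrix (Fin n) (Fin n) ℝ}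
    (hM : M.IsHermitian) (hG : eigs M ∈ GammaK n k) :
    (M + ∑ a ∈ s, Matrix.vecMulVec (B a) (B a)).IsHermitian ∧
    eigs (M + ∑ a ∈ s, Matrix.vecMulVec (B a) (B a)) ∈ GammaK n k ∧
    ∀ i, 1 ≤ i → i ≤ k → Sk n i M ≤ Sk n i (M + ∑ a ∈ s, Matrix.vecMulVec (B a) (B a)) := by
  induction s using Finset.induction_on with
  | empty => simpa using ⟨hM, hG⟩
  | insert a s ha ih =>
    obtain ⟨h1, h2, h3⟩ := ih
    rw [Finset.sum_insert ha, add_comm (Matrix.vecMulVec _ _), ← add_assoc]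
    have h4 := fun i hi hik => sk_mono_rank_one hk h1 h2 (B a) i hi hik
    refine ⟨?_, ?_, fun i hi hik => (h3 i hi hik).trans (h4 i hi hik)⟩
    · apply h1.add
      ext a b; simp [Matrix.vecMulVec_apply, mul_comm]
    · intro i hi hik
      exact (h2 i hi hik).trans (h4 i hi hik)

theorem sk_mono {n k : ℕ} (hk1 : 1 ≤ k) (hk : k ≤ n) {M N : Matrix (Fin n) (Fin n) ℝ}
    (hM : M.IsHermitian) (hG : eigs M ∈ GammaK n k) (hN : (N - M).PosSemidef) :
    Sk n k M ≤ Sk n k N := by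
  obtain ⟨B, hB⟩ : ∃ B : Matrix (Fin n) (Fin n) ℝ, N - M = B.conjTranspose * B := by
    open scoped MatrixOrder in
    exact CStarAlgebra.nonneg_iff_eq_star_mul_self.1 hN.nonneg
  have h := (sk_mono_sum hk Finset.univ (fun a => B a) hM hG).2.2 k hk1 le_rfl
  have e : N = M + ∑ a, Matrix.vecMulVec (B a) (B a) := by
    rw [← sub_eq_iff_eq_add', hB]
    ext i j
    simp [Matrix.mul_apply, Matrix.sum_apply, Matrix.vecMulVec_apply]
  rwa [e]

/-- shifting by a positive multiple of the identity. -/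
theorem sk_shift_lt {n k : ℕ} (hk : k ≤ n) {M : Matrix (Fin n) (Fin n) ℝ}
    (hM : M.IsHermitian) (hG : eigs M ∈ GammaK n k) (d : ℝ) (hd : 0 < d) (i : ℕ) (hi : 1 ≤ i)
    (hik : i ≤ k) : Sk n i M < Sk n i (M + Matrix.scalar (Fin n) d) := by
  rw [sk_shift hM, Sk, esymm_eq_es]
  apply es_shift _ k hk _ d hd i hi hik
  intro j hj hjk
  rw [← esymm_eq_es]; exact hG j hj hjk

theorem pd_lin {n : ℕ} {f g : E n → ℝ} {x : E n} (hf : DifferentiableAt ℝ f x)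
    (hg : DifferentiableAt ℝ g x) (a b : ℝ) (i : Fin n) :
    pd (fun y => a * f y + b * g y) i x = a * pd f i x + b * pd g i x := by
  unfold pd
  rw [fderiv_fun_add (hf.const_mul a) (hg.const_mul b), fderiv_const_mul hf, fderiv_const_mul hg]
  simp

theorem pd_diff {n : ℕ} {f : E n → ℝ} {x : E n} (hf : ContDiffAt ℝ 2 f x) (i : Fin n) :
    DifferentiableAt ℝ (fun y => pd f i y) x := by
  have h : ContDiffAt ℝ 1 (fderiv ℝ f) x := hf.fderiv_right (by norm_num)
  have := h.differentiableAt (by norm_num)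
  unfold pd
  fun_prop

theorem hess_lin {n : ℕ} {f g : E n → ℝ} {x : E n} (hf : ContDiffAt ℝ 2 f x)
    (hg : ContDiffAt ℝ 2 g x) (a b : ℝ) :
    hess (fun y => a * f y + b * g y) x = a • hess f x + b • hess g x := by
  ext i j
  simp only [hess, Matrix.of_apply, Matrix.add_apply, Matrix.smul_apply, smul_eq_mul]
  rw [← pd_lin (pd_diff hf j) (pd_diff hg j)]
  have : (fun y => pd (fun y => a * f y + b * g y) j y) =ᶠ[nhds x]
      (fun y => a * pd f j y + b * pd g j y) := by
    filter_upwards [hf.eventually (by simp), hg.eventually (by simp)] with y h1 h2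
    exact pd_lin (h1.differentiableAt (by norm_num)) (h2.differentiableAt (by norm_num)) a b j
  unfold pd at this ⊢
  rw [this.fderiv_eq]

theorem hess_apply {n : ℕ} {f : E n → ℝ} {x : E n} (hf : ContDiffAt ℝ 2 f x) (i j : Fin n) :
    hess f x i j = fderiv ℝ (fderiv ℝ f) x (EuclideanSpace.single i 1)
      (EuclideanSpace.single j 1) := by
  have h : ContDiffAt ℝ 1 (fderiv ℝ f) x := hf.fderiv_right (by norm_num)
  have := h.differentiableAt (by norm_num)
  simp only [hess, Matrix.of_apply, pd]
  rw [fderiv_clm_apply this (by fun_prop)]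
  simp

theorem hess_symm {n : ℕ} {f : E n → ℝ} {x : E n} (hf : ContDiffAt ℝ 2 f x) :
    (hess f x).IsHermitian := by
  ext i j
  rw [Matrix.conjTranspose_apply, hess_apply hf, hess_apply hf]
  simpa using (hf.isSymmSndFDerivAt (by simp)) _ _

theorem Amat_eq {n : ℕ} (f : E n → ℝ) (x : E n) :
    Amat f x = f x • hess f x - Matrix.scalar (Fin n) (1 / 2 * gradsq f x) := by
  ext i j
  by_cases h : i = j
  · subst h; simp [Amat]
  · simp [Amat, h]

theorem Amat_symm {n : ℕ} {f : E n → ℝ} {x : E n} (hf : ContDiffAt ℝ 2 f x) :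
    (Amat f x).IsHermitian := by
  rw [Amat_eq]
  apply Matrix.IsHermitian.sub
  · rw [Matrix.IsHermitian, Matrix.conjTranspose_smul, hess_symm hf]; simp
  · simp [Matrix.IsHermitian]

theorem second_deriv_nonneg {n : ℕ} {f : E n → ℝ} {x : E n} (hf : ContDiffAt ℝ 2 f x)
    (hm : IsLocalMin f x) (ξ : E n) : 0 ≤ fderiv ℝ (fderiv ℝ f) x ξ ξ := by
  by_contra hneg
  push Not at hneg
  have hL : ∀ t : ℝ, HasDerivAt (fun t : ℝ => x + t • ξ) ξ t := by
    intro t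
    simpa using ((hasDerivAt_id t).smul_const ξ).const_add x
  have hc : Filter.Tendsto (fun t : ℝ => x + t • ξ) (nhds 0) (nhds x) := by
    simpa using (hL 0).continuousAt.tendsto
  have hd1 : ∀ᶠ t in nhds (0:ℝ), deriv (fun t : ℝ => f (x + t • ξ)) t = fderiv ℝ f (x + t • ξ) ξ := by
    filter_upwards [hc.eventually (hf.eventually (by simp))] with t ht
    exact ((ht.differentiableAt (by norm_num)).hasFDerivAt.comp_hasDerivAt t (hL t)).deriv
  have h1 : DifferentiableAt ℝ (fderiv ℝ f) x :=
    ((hf.fderiv_right (m := 1) (by norm_num)).differentiableAt (by norm_num))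
  have hd2 : deriv (deriv (fun t : ℝ => f (x + t • ξ))) 0 = fderiv ℝ (fderiv ℝ f) x ξ ξ := by
    rw [Filter.EventuallyEq.deriv_eq hd1]
    have h1' : HasFDerivAt (fderiv ℝ f) (fderiv ℝ (fderiv ℝ f) x) (x + (0:ℝ) • ξ) := by
      simpa using h1.hasFDerivAt
    have h2 := h1'.comp_hasDerivAt (0:ℝ) (hL 0)
    have h3 := h2.clm_apply (hasDerivAt_const (0:ℝ) ξ)
    simpa using h3.deriv
  have hmin : IsLocalMin (fun t : ℝ => f (x + t • ξ)) 0 := by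
    have := hc.eventually hm
    filter_upwards [this] with t ht
    simpa using ht
  have hcont : ContinuousAt (fun t : ℝ => f (x + t • ξ)) 0 := by
    have : ContinuousAt f (x + (0:ℝ) • ξ) := by simpa using hf.continuousAt
    exact ContinuousAt.comp (f := fun t : ℝ => x + t • ξ) this (hL 0).continuousAt
  have hmax := isLocalMax_of_deriv_deriv_neg (by rw [hd2]; exact hneg) hmin.deriv_eq_zero hcont
  have hconst : (fun t : ℝ => f (x + t • ξ)) =ᶠ[nhds 0] (fun _ => f (x + (0:ℝ) • ξ)) := by
    filter_upwards [hmin, hmax] with t h1 h2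
    exact le_antisymm h2 h1
  have := hconst.deriv.deriv_eq
  rw [hd2] at this
  simp at this
  linarith

theorem hess_psd {n : ℕ} {f : E n → ℝ} {x : E n} (hf : ContDiffAt ℝ 2 f x)
    (hm : IsLocalMin f x) : (hess f x).PosSemidef := by
  refine Matrix.PosSemidef.of_dotProduct_mulVec_nonneg (hess_symm hf) fun ξ => ?_
  have h := second_deriv_nonneg hf hm (∑ i, ξ i • EuclideanSpace.single i (1:ℝ))
  refine h.trans_eq ?_
  simp only [map_sum, map_smul, sum_apply, smul_apply,
    smul_eq_mul, ← hess_apply hf, dotProduct, Matrix.mulVec, Finset.mul_sum, star_trivial]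
  rw [Finset.sum_comm]
  refine Finset.sum_congr rfl fun i _ => Finset.sum_congr rfl fun j _ => ?_
  have := (hess_symm hf).apply i j
  simp only [star_trivial] at this
  first
  | ring
  | (rw [this]; ring)
  | (rw [← this]; ring)

theorem pd_zero {n : ℕ} {f : E n → ℝ} {x : E n} (hm : IsLocalMin f x) (i : Fin n) :
    pd f i x = 0 := by
  rw [pd, hm.fderiv_eq_zero]; simp

/-- The auxiliary function `|x|^2 + 1`. -/
def hh {n : ℕ} (x : E n) : ℝ := ∑ i, x i ^ 2 + 1

theorem hh_contDiff {n : ℕ} : ContDiff ℝ 2 (hh (n := n)) := by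
  unfold hh
  fun_prop

theorem hh_pd {n : ℕ} (i : Fin n) (x : E n) : pd hh i x = 2 * x i := by
  have h : HasFDerivAt (hh (n := n))
      (∑ j, (2 * x j) • (EuclideanSpace.proj j : E n →L[ℝ] ℝ)) x := by
    unfold hh
    apply HasFDerivAt.add_const
    apply HasFDerivAt.fun_sum
    intro j _
    have := ((EuclideanSpace.proj j : E n →L[ℝ] ℝ).hasFDerivAt (x := x)).pow 2
    simpa using this
  rw [pd, h.fderiv]
  simp

theorem hh_hess {n : ℕ} (x : E n) : hess hh x = Matrix.scalar (Fin n) 2 := by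
  ext i j
  simp only [hess, Matrix.of_apply, hh_pd]
  have : HasFDerivAt (fun y : E n => 2 * y j) ((2:ℝ) • (EuclideanSpace.proj j : E n →L[ℝ] ℝ)) x :=
    ((EuclideanSpace.proj j : E n →L[ℝ] ℝ).hasFDerivAt (x := x)).const_mul 2
  rw [pd, this.fderiv]
  by_cases h : i = j
  · subst h; simp
  · simp [h, Ne.symm h]

theorem Amat_perturb {n : ℕ} {u : E n → ℝ} {x : E n} (hu : ContDiffAt ℝ 2 u x) (hpos : 0 < u x)
    (e : ℝ) (he : 0 < e) : ∃ d > 0, Amat (fun y => 1 * u y + e * hh y) x =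
      ((u x + e * hh x) / u x) • (Amat u x + Matrix.scalar (Fin n) d) := by
  have hhx : ContDiffAt ℝ 2 (hh (n := n)) x := hh_contDiff.contDiffAt
  have hhpos : 0 < hh x := by unfold hh; positivity
  have hG : gradsq (fun y => 1 * u y + e * hh y) x =
      gradsq u x + 4 * e * (∑ i, pd u i x * x i) + 4 * e ^ 2 * (∑ i, x i ^ 2) := by
    simp only [gradsq, Finset.mul_sum, ← Finset.sum_add_distrib]
    apply Finset.sum_congr rfl
    intro i _
    rw [pd_lin (hu.differentiableAt (by norm_num)) (hhx.differentiableAt (by norm_num)), hh_pd]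
    ring
  have hCS : (∑ i, pd u i x * x i) ^ 2 ≤ gradsq u x * (∑ i, x i ^ 2) :=
    Finset.sum_mul_sq_le_sq_mul_sq _ _ _
  have hGu : 0 ≤ gradsq u x := by unfold gradsq; positivity
  rw [Amat_eq, Amat_eq, hess_lin hu hhx, hh_hess, hG]
  have hhd : hh x = ∑ i, x i ^ 2 + 1 := rfl
  generalize (∑ i, pd u i x * x i) = P at *
  generalize (∑ i, x i ^ 2) = R at *
  generalize gradsq u x = G at *
  generalize hh x = H at *
  generalize u x = U at *
  have hW : 0 < U + e * H := by positivity
  refine ⟨2 * e * U - 1 / 2 * (U / (U + e * H)) * (G + 4 * e * P + 4 * e ^ 2 * R) + 1 / 2 * G,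
    ?_, ?_⟩
  · have : 2 * e * U - 1 / 2 * (U / (U + e * H)) * (G + 4 * e * P + 4 * e ^ 2 * R) + 1 / 2 * G =
      (e * (1/2 * (2 * U - P) ^ 2 + 1 / 2 * (G * R - P ^ 2) + 1/2 * G) + 2 * e ^ 2 * U)
        / (U + e * H) := by
      field_simp
      rw [hhd]; ring
    rw [this]
    apply div_pos _ hW
    have h1 : 0 ≤ G * R - P ^ 2 := by linarith
    have h2 := sq_nonneg (2 * U - P)
    have : 0 ≤ 1/2 * (2 * U - P) ^ 2 + 1 / 2 * (G * R - P ^ 2) + 1/2 * G := by linarith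
    positivity
  · ext i j
    by_cases h : i = j
    · subst h
      simp
      field_simp
      ring
    · simp [h]
      field_simp

theorem stmt14 (n k : ℕ) (hk : 1 ≤ k) (hkn : 2 * k < n)
    (Ω : Set (E n)) (hΩ : IsOpen Ω) (hΩb : Bornology.IsBounded Ω)
    (u v : E n → ℝ)
    (hu : ContDiffOn ℝ 2 u (closure Ω)) (hv : ContDiffOn ℝ 2 v (closure Ω))
    (hupos : ∀ x ∈ closure Ω, 0 < u x) (hvpos : ∀ x ∈ closure Ω, 0 < v x)
    (huG : ∀ x ∈ closure Ω, eigs (Amat u x) ∈ GammaK n k)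
    (hvG : ∀ x ∈ closure Ω, eigs (Amat v x) ∈ GammaK n k)
    (hineq : ∀ x ∈ Ω, v x ^ (-(n : ℤ)) * Sk n k (Amat v x) ≤
      u x ^ (-(n : ℤ)) * Sk n k (Amat u x))
    (hbd : ∀ x ∈ frontier Ω, u x ≤ v x)
    (hrigid : ∀ U : Set (E n), IsOpen U → U ⊆ Ω → (∀ x ∈ U, v x < u x) →
      (∀ t ∈ Set.Icc (0 : ℝ) 1, ∀ x ∈ U,
        Sk n k (Amat (fun y => (1 - t) * u y + t * v y) x) = 0) →
      ∀ x ∈ U, u x = v x) :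
    ∀ x ∈ Ω, u x ≤ v x := by
  intro x₁ hx₁
  by_contra hcon
  push Not at hcon
  have hv₁ := hvpos x₁ (subset_closure hx₁)
  have hK : IsCompact (closure Ω) := hΩb.isCompact_closure
  have hhc : Continuous (hh (n := n)) := hh_contDiff.continuous
  have hhpos : ∀ x : E n, 0 < hh x := fun x => by unfold hh; positivity
  set c₁ := u x₁ / v x₁ with hc₁
  have hc₁1 : 1 < c₁ := by rw [hc₁, one_lt_div hv₁]; exact hcon
  -- choose r
  obtain ⟨r, hr1, hr⟩ : ∃ r > (1:ℝ), r ^ (n - k) ≤ c₁ ^ (n - 2 * k) := by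
    have ht : Filter.Tendsto (fun r : ℝ => r ^ (n - k)) (nhdsWithin 1 (Set.Ioi 1)) (nhds 1) := by
      have := ((continuous_pow (n - k)).tendsto (1:ℝ)).mono_left
        (nhdsWithin_le_nhds (s := Set.Ioi 1))
      simpa using this
    have h1 : (1:ℝ) < c₁ ^ (n - 2 * k) := one_lt_pow₀ hc₁1 (by omega)
    obtain ⟨r, h2, h3⟩ := ((ht.eventually (gt_mem_nhds h1)).and self_mem_nhdsWithin).exists
    exact ⟨r, h3, h2.le⟩
  -- bound
  have hucont := hu.continuousOn
  have hvcont := hv.continuousOn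
  obtain ⟨K₁, hK₁⟩ := hK.bddAbove_image (f := fun x => hh x / u x)
    (hhc.continuousOn.div hucont fun x hx => (hupos x hx).ne')
  obtain ⟨K₂, hK₂⟩ := hK.bddAbove_image (f := fun x => hh x / v x)
    (hhc.continuousOn.div hvcont fun x hx => (hvpos x hx).ne')
  have hK₁' : ∀ x ∈ closure Ω, hh x / u x ≤ K₁ := fun x hx => hK₁ (Set.mem_image_of_mem _ hx)
  have hK₂' : ∀ x ∈ closure Ω, hh x / v x ≤ K₂ := fun x hx => hK₂ (Set.mem_image_of_mem _ hx)
  obtain ⟨K, hKpos, hKu, hKv⟩ : ∃ K > (0:ℝ), (∀ x ∈ closure Ω, hh x ≤ K * u x) ∧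
      (∀ x ∈ closure Ω, hh x ≤ K * v x) := by
    refine ⟨max 1 (max K₁ K₂), by positivity, fun x hx => ?_, fun x hx => ?_⟩
    · rw [← div_le_iff₀ (hupos x hx)]
      exact (hK₁' x hx).trans ((le_max_left _ _).trans (le_max_right _ _))
    · rw [← div_le_iff₀ (hvpos x hx)]
      exact (hK₂' x hx).trans ((le_max_right _ _).trans (le_max_right _ _))
  set m := min (c₁ - 1) (r - 1) / 2 with hm
  have hmpos : 0 < m := by
    have : 0 < min (c₁ - 1) (r - 1) := lt_min (by linarith) (by linarith)
    positivity
  have hmc : m < c₁ - 1 := by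
    have := min_le_left (c₁ - 1) (r - 1); linarith
  have hmr : m ≤ r - 1 := by
    have := min_le_right (c₁ - 1) (r - 1); linarith
  set e := m / K with he
  have hepos : 0 < e := by positivity
  have heK : e * K = m := by rw [he]; field_simp
  have heu : ∀ x ∈ closure Ω, e * hh x ≤ m * u x := by
    intro x hx
    calc e * hh x ≤ e * (K * u x) := mul_le_mul_of_nonneg_left (hKu x hx) hepos.le
      _ = m * u x := by rw [← heK]; ring
  have hev : ∀ x ∈ closure Ω, e * hh x ≤ m * v x := by
    intro x hx
    calc e * hh x ≤ e * (K * v x) := mul_le_mul_of_nonneg_left (hKv x hx) hepos.le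
      _ = m * v x := by rw [← heK]; ring
  -- maximum point
  obtain ⟨x₀, hx₀, hmax⟩ := hK.exists_isMaxOn ⟨x₁, subset_closure hx₁⟩
    (f := fun x => (u x + e * hh x) / v x)
    ((hucont.add (hhc.continuousOn.const_smul e)).div hvcont fun x hx => (hvpos x hx).ne')
  set c := (u x₀ + e * hh x₀) / v x₀ with hc
  have hv₀ := hvpos x₀ hx₀
  have hu₀ := hupos x₀ hx₀
  have hle : ∀ x ∈ closure Ω, u x + e * hh x ≤ c * v x := by
    intro x hx
    rw [← div_le_iff₀ (hvpos x hx)]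
    exact hmax hx
  have hcc : c₁ ≤ c := by
    have h1 := hle x₁ (subset_closure hx₁)
    rw [hc₁, div_le_iff₀ hv₁]
    have := mul_pos hepos (hhpos x₁)
    linarith
  have hcv : c * v x₀ = u x₀ + e * hh x₀ := by rw [hc]; field_simp
  have hx₀Ω : x₀ ∈ Ω := by
    by_contra hn
    have hf : x₀ ∈ frontier Ω := ⟨hx₀, by rwa [hΩ.interior_eq]⟩
    have h1 := hbd x₀ hf
    have h2 := hev x₀ hx₀
    have h3 : c * v x₀ ≤ (1 + m) * v x₀ := by linarith
    have := le_of_mul_le_mul_right h3 hv₀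
    linarith
  have hnh : closure Ω ∈ nhds x₀ := Filter.mem_of_superset (hΩ.mem_nhds hx₀Ω) subset_closure
  have hu2 : ContDiffAt ℝ 2 u x₀ := hu.contDiffAt hnh
  have hv2 : ContDiffAt ℝ 2 v x₀ := hv.contDiffAt hnh
  have hh2 : ContDiffAt ℝ 2 (hh (n := n)) x₀ := hh_contDiff.contDiffAt
  set w : E n → ℝ := fun y => 1 * u y + e * hh y with hw
  have hw2 : ContDiffAt ℝ 2 w x₀ := (contDiffAt_const.mul hu2).add (contDiffAt_const.mul hh2)
  have hw0 : w x₀ = c * v x₀ := by rw [hcv]; simp [hw]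
  have hmin : IsLocalMin (fun y => c * v y + (-1) * w y) x₀ := by
    filter_upwards [hnh] with y hy
    have := hle y hy
    simp only [hw0]
    simp only [hw]
    linarith
  have hg2 : ContDiffAt ℝ 2 (fun y => c * v y + (-1) * w y) x₀ :=
    (contDiffAt_const.mul hv2).add (contDiffAt_const.mul hw2)
  have hpsd := hess_psd hg2 hmin
  rw [hess_lin hv2 hw2] at hpsd
  have hpd : ∀ i, pd w i x₀ = c * pd v i x₀ := by
    intro i
    have := pd_zero hmin i
    rw [pd_lin (hv2.differentiableAt (by norm_num)) (hw2.differentiableAt (by norm_num))] at this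
    linarith
  have hcpos : 0 < c := by linarith
  -- the two matrices at the maximum point
  have hdiff : (c ^ 2 • Amat v x₀ - Amat w x₀).PosSemidef := by
    have hgr : gradsq w x₀ = c ^ 2 * gradsq v x₀ := by
      simp only [gradsq, Finset.mul_sum, hpd, mul_pow]
    have : c ^ 2 • Amat v x₀ - Amat w x₀ = (c * v x₀) • (c • hess v x₀ + (-1:ℝ) • hess w x₀) := by
      rw [Amat_eq, Amat_eq, hgr, hw0]
      ext i j
      by_cases h : i = j
      · subst h; simp; ring
      · simp [h]; ring
    rw [this]
    exact hpsd.smul (by positivity)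
  obtain ⟨d, hd, hA⟩ := Amat_perturb hu2 hu₀ e hepos
  rw [← hw] at hA
  set a := (u x₀ + e * hh x₀) / u x₀ with ha
  have hau : a * u x₀ = c * v x₀ := by rw [hcv, ha]; field_simp
  have hapos : 0 < a := by have := hhpos x₀; positivity
  have har : a ≤ r := by
    rw [ha, div_le_iff₀ hu₀]
    have := heu x₀ hx₀
    nlinarith
  have hkn' : k ≤ n := by omega
  have hAu := Amat_symm hu2
  have hAud : (Amat u x₀ + Matrix.scalar (Fin n) d).IsHermitian := by
    apply hAu.add; simp [Matrix.IsHermitian]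
  have hskw : ∀ i, Sk n i (Amat w x₀) = a ^ i * Sk n i (Amat u x₀ + Matrix.scalar (Fin n) d) := by
    intro i
    rw [hA, sk_smul hAud a hapos.ne']
  have hlt := fun i hi hik => sk_shift_lt hkn' hAu (huG x₀ hx₀) d hd i hi hik
  have hwG : eigs (Amat w x₀) ∈ GammaK n k := by
    intro i hi hik
    have h1 := hskw i
    have h2 := hlt i hi hik
    have h3 : 0 ≤ Sk n i (Amat u x₀) := huG x₀ hx₀ i hi hik
    change 0 ≤ Sk n i (Amat w x₀)
    rw [h1]
    have : 0 ≤ Sk n i (Amat u x₀ + Matrix.scalar (Fin n) d) := by linarith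
    positivity
  have hmono := sk_mono hk hkn' (Amat_symm hw2) hwG hdiff
  rw [sk_smul (Amat_symm hv2) _ (by positivity), hskw k] at hmono
  have hltk := hlt k hk le_rfl
  have hSu : 0 ≤ Sk n k (Amat u x₀) := huG x₀ hx₀ k hk le_rfl
  have hS := hineq x₀ hx₀Ω
  rw [zpow_neg, zpow_neg, zpow_natCast, zpow_natCast, inv_mul_le_iff₀ (by positivity),
    ← mul_assoc, ← div_eq_mul_inv, div_mul_eq_mul_div, le_div_iff₀ (by positivity)] at hS
  generalize Sk n k (Amat u x₀) = SU at *
  generalize Sk n k (Amat v x₀) = SV at *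
  generalize Sk n k (Amat u x₀ + Matrix.scalar (Fin n) d) = SD at *
  have hac : a ^ (n - k) ≤ c ^ (n - 2 * k) :=
    (pow_le_pow_left₀ hapos.le har _).trans (hr.trans (pow_le_pow_left₀ (by linarith) hcc _))
  have f1 : a ^ k * SU < (c ^ 2) ^ k * SV :=
    lt_of_lt_of_le (mul_lt_mul_of_pos_left hltk (by positivity)) hmono
  have f2 : c ^ (n - 2 * k) * u x₀ ^ n * (a ^ k * SU) <
      c ^ (n - 2 * k) * u x₀ ^ n * ((c ^ 2) ^ k * SV) :=
    mul_lt_mul_of_pos_left f1 (by positivity)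
  have f3 : c ^ (n - 2 * k) * u x₀ ^ n * ((c ^ 2) ^ k * SV) ≤ c ^ n * (v x₀ ^ n * SU) := by
    have : c ^ n = c ^ (n - 2 * k) * (c ^ 2) ^ k := by
      rw [← pow_mul, ← pow_add]; congr 1; omega
    rw [this]
    calc _ = c ^ (n - 2 * k) * (c ^ 2) ^ k * (SV * u x₀ ^ n) := by ring
      _ ≤ _ := mul_le_mul_of_nonneg_left hS (by positivity)
  have f4 : c ^ n * (v x₀ ^ n * SU) = u x₀ ^ n * (a ^ k * SU) * a ^ (n - k) := by
    have h1 : a ^ n = a ^ k * a ^ (n - k) := by rw [← pow_add]; congr 1; omega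
    calc c ^ n * (v x₀ ^ n * SU) = (c * v x₀) ^ n * SU := by rw [mul_pow]; ring
      _ = (a * u x₀) ^ n * SU := by rw [hau]
      _ = _ := by rw [mul_pow, h1]; ring
  have f5 : u x₀ ^ n * (a ^ k * SU) * a ^ (n - k) ≤ u x₀ ^ n * (a ^ k * SU) * c ^ (n - 2 * k) :=
    mul_le_mul_of_nonneg_left hac (by positivity)
  have f6 : c ^ (n - 2 * k) * u x₀ ^ n * (a ^ k * SU) =
    u x₀ ^ n * (a ^ k * SU) * c ^ (n - 2 * k) := by ring
  linarith
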